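/- arXiv:0708.1586 — 4 statements merged into one kernel-verified Lean document; each statement's English description precedes it below -/
import Mathlib

section
/- Let V and T̂ be finite-dimensional real vector spaces with n̂ = dim T̂, let ω̂ be a nonvanishing T̂-valued (k+1)-form on V, and let L be a subspace of V of codimension N ≥ k. Then the following are equivalent: (i) L is a polylagrangian subspace for ω̂ (so ω̂ is polylagrangian of rank N); (ii) L contains ker ω̂, L is isotropic with respect to ω̂, and dim L = dim ker ω̂ + n̂·C(N,k), where C(N,k) is the binomial coefficient. -/
open Module

/-- `L` is a polylagrangian subspace for the `T`-valued `(k+1)`-form `ω`. -/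
def IsPolyLag {V T : Type*} [AddCommGroup V] [Module ℝ V] [AddCommGroup T] [Module ℝ T]
    {k : ℕ} (ω : V [⋀^Fin (k+1)]→ₗ[ℝ] T) (L : Submodule ℝ V) : Prop :=
  ∀ α : V [⋀^Fin k]→ₗ[ℝ] T,
    (∃ v ∈ L, ∀ x : Fin k → V, ω (Fin.cons v x) = α x)
      ↔ ∀ (x : Fin k → V) (i : Fin k), x i ∈ L → α x = 0

namespace AlternatingMap

variable {R M N ι : Type*} [CommRing R] [AddCommGroup M] [Module R M]
  [AddCommGroup N] [Module R N]

/-- The `N`-valued alternating maps on `M` that vanish as soon as one argument lies in `L`. -/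
def vanishingOn (N ι : Type*) [AddCommGroup N] [Module R N] (L : Submodule R M) :
    Submodule R (M [⋀^ι]→ₗ[R] N) where
  carrier := {α | ∀ x i, x i ∈ L → α x = 0}
  zero_mem' _ _ _ := rfl
  add_mem' ha hb x i h := by simp [ha x i h, hb x i h]
  smul_mem' c _ ha x i h := by simp [ha x i h]

theorem mem_vanishingOn {L : Submodule R M} {α : M [⋀^ι]→ₗ[R] N} :
    α ∈ vanishingOn N ι L ↔ ∀ x i, x i ∈ L → α x = 0 :=
  Iff.rfl

theorem curryLeft_apply_tail {n : ℕ} (α : M [⋀^Fin (n + 1)]→ₗ[R] N) (x : Fin (n + 1) → M) :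
    α.curryLeft (x 0) (Fin.tail x) = α x :=
  congrArg α (Fin.cons_self_tail x)

theorem mem_vanishingOn_iff_le_ker_curryLeft {n : ℕ} {L : Submodule R M}
    {α : M [⋀^Fin (n + 1)]→ₗ[R] N} :
    α ∈ vanishingOn N (Fin (n + 1)) L ↔ L ≤ LinearMap.ker α.curryLeft := by
  refine ⟨fun h v hv => LinearMap.mem_ker.2 (ext fun x => h _ 0 hv), fun h x i hx => ?_⟩
  have hzero : ∀ y : Fin (n + 1) → M, y 0 ∈ L → α y = 0 := fun y hy => by
    rw [← curryLeft_apply_tail, LinearMap.mem_ker.1 (h hy), zero_apply]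
  by_cases hi : (0 : Fin (n + 1)) = i
  · exact hzero x (hi ▸ hx)
  · rw [← neg_eq_zero, ← α.map_swap x hi]
    exact hzero _ (by simpa using hx)

/-- An alternating map vanishing on `L` only depends on its arguments modulo `L`. -/
theorem eq_of_mem_vanishingOn [Fintype ι] {L : Submodule R M} {α : M [⋀^ι]→ₗ[R] N}
    (hα : α ∈ vanishingOn N ι L) {x y : ι → M} (h : ∀ i, x i - y i ∈ L) : α x = α y := by
  classical
  have hadd := α.toMultilinearMap.map_add_univ y (x - y)
  rw [add_sub_cancel, Finset.sum_eq_single Finset.univ] at hadd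
  · simpa using hadd
  · intro s _ hs
    obtain ⟨i, hi⟩ : ∃ i, i ∉ s := by
      by_contra! hall
      exact hs (Finset.eq_univ_iff_forall.2 hall)
    exact hα _ i (by simpa [hi] using h i)
  · simp

/-- Pullback of alternating maps along the projection to a quotient. -/
def compMkQ (N ι : Type*) [AddCommGroup N] [Module R N] (L : Submodule R M) :
    ((M ⧸ L) [⋀^ι]→ₗ[R] N) →ₗ[R] M [⋀^ι]→ₗ[R] N where
  toFun α := α.compLinearMap L.mkQ
  map_add' _ _ := rfl
  map_smul' _ _ := rfl

theorem compMkQ_injective (L : Submodule R M) : Function.Injective (compMkQ N ι L) :=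
  compLinearMap_injective _ L.mkQ_surjective

end AlternatingMap

namespace AlternatingMap

variable {K V T : Type*} [Field K] [AddCommGroup V] [Module K V] [AddCommGroup T] [Module K T]

theorem range_compMkQ {ι : Type*} [Fintype ι] (L : Submodule K V) :
    LinearMap.range (compMkQ T ι L) = vanishingOn T ι L := by
  apply le_antisymm
  · rintro _ ⟨α, rfl⟩ x i hx
    exact α.map_coord_zero i ((Submodule.Quotient.mk_eq_zero L).2 hx)
  · intro α hα
    obtain ⟨s, hs⟩ := L.mkQ.exists_rightInverse_of_surjective L.range_mkQ
    refine ⟨α.compLinearMap s, ext fun x => eq_of_mem_vanishingOn hα fun i => ?_⟩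
    rw [← Submodule.Quotient.mk_eq_zero, Submodule.Quotient.mk_sub, sub_eq_zero]
    exact LinearMap.congr_fun hs (L.mkQ (x i))

variable [FiniteDimensional K V]

theorem finrank_vanishingOn (k : ℕ) (L : Submodule K V) :
    finrank K (vanishingOn T (Fin k) L) = finrank K T * (finrank K (V ⧸ L)).choose k := by
  rw [← range_compMkQ, LinearMap.finrank_range_of_inj (compMkQ_injective L),
    exteriorPower.alternatingMapLinearEquiv.finrank_eq, Module.finrank_linearMap,
    exteriorPower.finrank_eq, mul_comm]

/-- The subspace on which all alternating maps vanishing on `L` vanish is `L` itself, provided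
there are nonzero ones. -/
theorem le_of_vanishingOn_le [FiniteDimensional K T] [Nontrivial T] {k : ℕ} (hk : 1 ≤ k)
    {L L' : Submodule K V} (hL : k ≤ finrank K (V ⧸ L)) (hLL' : L ≤ L')
    (h : vanishingOn T (Fin k) L ≤ vanishingOn T (Fin k) L') : L' ≤ L := by
  by_contra hle
  have : FiniteDimensional K (V [⋀^Fin k]→ₗ[K] T) :=
    .equiv exteriorPower.alternatingMapLinearEquiv.symm
  have hfin := Submodule.finrank_mono h
  rw [finrank_vanishingOn, finrank_vanishingOn] at hfin
  have hchoose := Nat.le_of_mul_le_mul_left hfin Module.finrank_pos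
  have hlt := Submodule.finrank_lt_finrank_of_lt (lt_of_le_not_ge hLL' hle)
  have hsum := L.finrank_quotient_add_finrank
  have hsum' := L'.finrank_quotient_add_finrank
  obtain ⟨m, rfl⟩ := Nat.exists_eq_add_of_le' hk
  obtain ⟨n, hn⟩ : ∃ n, finrank K (V ⧸ L) = n + 1 := ⟨finrank K (V ⧸ L) - 1, by omega⟩
  have hmono := Nat.choose_le_choose (m + 1) (show finrank K (V ⧸ L') ≤ n by omega)
  rw [hn, Nat.choose_succ_succ'] at hchoose
  have := Nat.choose_pos (show m ≤ n by omega)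
  omega

end AlternatingMap

open AlternatingMap

theorem isPolyLag_iff_map_curryLeft {V T : Type*} [AddCommGroup V] [Module ℝ V]
    [AddCommGroup T] [Module ℝ T] {k : ℕ} {ω : V [⋀^Fin (k+1)]→ₗ[ℝ] T} {L : Submodule ℝ V} :
    IsPolyLag ω L ↔ L.map ω.curryLeft = vanishingOn T (Fin k) L := by
  simp only [IsPolyLag, SetLike.ext_iff, Submodule.mem_map, AlternatingMap.ext_iff,
    mem_vanishingOn]
  rfl

theorem map_curryLeft_le_vanishingOn_iff {V T : Type*} [AddCommGroup V] [Module ℝ V]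
    [AddCommGroup T] [Module ℝ T] {m : ℕ} {ω : V [⋀^Fin (m+1+1)]→ₗ[ℝ] T} {L : Submodule ℝ V} :
    L.map ω.curryLeft ≤ vanishingOn T (Fin (m + 1)) L ↔
      ∀ x : Fin (m+1+1) → V, x 0 ∈ L → x 1 ∈ L → ω x = 0 := by
  constructor
  · intro h x h0 h1
    rw [← curryLeft_apply_tail]
    exact h (Submodule.mem_map_of_mem h0) (Fin.tail x) 0 h1
  · rintro h _ ⟨u, hu, rfl⟩
    rw [mem_vanishingOn_iff_le_ker_curryLeft]
    exact fun v hv => LinearMap.mem_ker.2 (AlternatingMap.ext fun y => h _ hu hv)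

theorem finrank_eq_finrank_ker_add_finrank_map {K V W : Type*} [Field K] [AddCommGroup V]
    [Module K V] [FiniteDimensional K V] [AddCommGroup W] [Module K W] (f : V →ₗ[K] W)
    {L : Submodule K V} (h : LinearMap.ker f ≤ L) :
    finrank K L = finrank K (LinearMap.ker f) + finrank K (L.map f) := by
  have := (f.domRestrict L).finrank_range_add_finrank_ker
  rw [LinearMap.range_domRestrict, LinearMap.ker_domRestrict,
    (Submodule.comapSubtypeEquivOfLe h).finrank_eq] at this
  omega

/-- Dimension criterion: for a nonvanishing `T`-valued `(k+1)`-form `ω` and a subspace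
`L` of codimension `N ≥ k`, `L` is polylagrangian iff it contains `ker ω`, is isotropic,
and `dim L = dim ker ω + n̂·C(N,k)` where `n̂ = dim T`. -/
theorem stmt4 {V T : Type*} [AddCommGroup V] [Module ℝ V] [FiniteDimensional ℝ V]
    [AddCommGroup T] [Module ℝ T] [FiniteDimensional ℝ T] {k N : ℕ} (hk : 1 ≤ k)
    (ω : V [⋀^Fin (k+1)]→ₗ[ℝ] T) (hω : ω ≠ 0)
    (L : Submodule ℝ V) (hN : Module.finrank ℝ (V ⧸ L) = N) (hNk : k ≤ N) :
    IsPolyLag ω L ↔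
      (LinearMap.ker ω.curryLeft ≤ L
        ∧ (∀ x : Fin (k+1) → V, x 0 ∈ L → x 1 ∈ L → ω x = 0)
        ∧ Module.finrank ℝ ↥L
            = Module.finrank ℝ ↥(LinearMap.ker ω.curryLeft)
              + Module.finrank ℝ T * N.choose k) := by
  rw [isPolyLag_iff_map_curryLeft]
  subst hN
  have : Nontrivial T := by
    by_contra hT
    rw [not_nontrivial_iff_subsingleton] at hT
    exact hω (AlternatingMap.ext fun _ => Subsingleton.elim _ _)
  have : FiniteDimensional ℝ (V [⋀^Fin k]→ₗ[ℝ] T) :=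
    .equiv exteriorPower.alternatingMapLinearEquiv.symm
  rw [← finrank_vanishingOn]
  obtain ⟨m, rfl⟩ := Nat.exists_eq_add_of_le' hk
  rw [← map_curryLeft_le_vanishingOn_iff]
  constructor
  · intro h
    have hker : LinearMap.ker ω.curryLeft ≤ L := by
      refine le_sup_right.trans (le_of_vanishingOn_le (T := T) hk hNk le_sup_left fun α hα => ?_)
      rw [mem_vanishingOn_iff_le_ker_curryLeft] at hα ⊢
      refine sup_le hα fun v hv => LinearMap.mem_ker.2 (AlternatingMap.ext fun y => ?_)
      rw [← mem_vanishingOn_iff_le_ker_curryLeft, ← h] at hα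
      obtain ⟨u, -, rfl⟩ := hα
      exact mem_vanishingOn_iff_le_ker_curryLeft.2 le_rfl _ 1 hv
    exact ⟨hker, h.le, h ▸ finrank_eq_finrank_ker_add_finrank_map _ hker⟩
  · rintro ⟨hker, hiso, hdim⟩
    refine Submodule.eq_of_le_of_finrank_eq hiso ?_
    have := finrank_eq_finrank_ker_add_finrank_map _ hker
    omega
end

section
/- Let V and T̂ be finite-dimensional real vector spaces with n̂ = dim T̂ ≥ 2, let ω̂ be a T̂-valued polylagrangian (k+1)-form of rank N on V with polylagrangian subspace L, and fix a basis {ê₁,…,ê_n̂} of T̂ with dual basis {ê¹,…,ê^n̂}; set ω^a = ⟨ê^a, ω̂⟩. Then for each a, dim ker ω^a = dim ker ω̂ + (n̂−1)·C(N,k), and L = ker ω^a ⊕ K_a where K_a is any complement of ker ω̂ in ⋂_{b≠a} ker ω^b, and dim K_a = C(N,k). -/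
open Module

/-- The `n`-forms that vanish as soon as one argument lies in `L`, i.e. `Λⁿ` of the annihilator
of `L`. -/
def formsVanishingOn {V : Type*} [AddCommGroup V] [Module ℝ V] (L : Submodule ℝ V) (n : ℕ) :
    Submodule ℝ (V [⋀^Fin n]→ₗ[ℝ] ℝ) where
  carrier := {α | ∀ (x : Fin n → V) (i : Fin n), x i ∈ L → α x = 0}
  zero_mem' := fun _ _ _ => rfl
  add_mem' := fun {α β} hα hβ x i hi => by
    rw [AlternatingMap.add_apply, hα x i hi, hβ x i hi, add_zero]
  smul_mem' := fun c α hα x i hi => by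
    rw [AlternatingMap.smul_apply, hα x i hi, smul_zero]

section

variable {V E : Type*} [AddCommGroup V] [Module ℝ V] [AddCommGroup E] [Module ℝ E]

theorem AlternatingMap.apply_add_of_vanish {n : ℕ} {L : Submodule ℝ V} (α : V [⋀^Fin n]→ₗ[ℝ] E)
    (hα : ∀ (x : Fin n → V) (i : Fin n), x i ∈ L → α x = 0)
    (l x : Fin n → V) (hl : ∀ i, l i ∈ L) : α (l + x) = α x := by
  have h := α.toMultilinearMap.map_add_univ l x
  rw [Finset.sum_eq_single ∅] at h
  · simpa using h
  · intro s _ hs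
    obtain ⟨i, hi⟩ := Finset.nonempty_iff_ne_empty.2 hs
    exact hα _ i (by simpa [Finset.piecewise, hi] using hl i)
  · simp

/-- A form vanishing on `L` descends to the quotient by `L`. -/
theorem AlternatingMap.exists_eq_compLinearMap_mkQ {n : ℕ} (L : Submodule ℝ V)
    (α : V [⋀^Fin n]→ₗ[ℝ] E)
    (hα : ∀ (x : Fin n → V) (i : Fin n), x i ∈ L → α x = 0) :
    ∃ β : (V ⧸ L) [⋀^Fin n]→ₗ[ℝ] E, β.compLinearMap L.mkQ = α := by
  obtain ⟨s, hs⟩ := L.mkQ.exists_rightInverse_of_surjective L.range_mkQ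
  refine ⟨α.compLinearMap s, ?_⟩
  ext x
  have hmem : ∀ i, s (L.mkQ (x i)) - x i ∈ L := fun i => by
    rw [← Submodule.Quotient.mk_eq_zero, ← L.mkQ_apply, map_sub, ← LinearMap.comp_apply, hs,
      LinearMap.id_apply, sub_self]
  have := α.apply_add_of_vanish hα (fun i => s (L.mkQ (x i)) - x i) x hmem
  rw [← this]
  simp only [AlternatingMap.compLinearMap_apply]
  congr 1
  ext i
  simp

theorem AlternatingMap.finset_sum_apply {n : ℕ} {ι : Type*} (s : Finset ι)
    (f : ι → V [⋀^Fin n]→ₗ[ℝ] E) (x : Fin n → V) : (∑ c ∈ s, f c) x = ∑ c ∈ s, f c x := by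
  classical
  induction s using Finset.induction_on with
  | empty => simp
  | insert c s hc ih => rw [Finset.sum_insert hc, Finset.sum_insert hc, add_apply, ih]

theorem compLinearMap_mkQ_mem {n : ℕ} (L : Submodule ℝ V) (β : (V ⧸ L) [⋀^Fin n]→ₗ[ℝ] ℝ) :
    β.compLinearMap L.mkQ ∈ formsVanishingOn L n := by
  intro x i hi
  rw [AlternatingMap.compLinearMap_apply]
  exact β.map_coord_zero i (by simpa using hi)

theorem finrank_alternatingMap [FiniteDimensional ℝ V] (n : ℕ) :
    finrank ℝ (V [⋀^Fin n]→ₗ[ℝ] ℝ) = (finrank ℝ V).choose n := by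
  rw [(exteriorPower.alternatingMapLinearEquiv (R := ℝ) (M := V) (N := ℝ) (n := n)).finrank_eq,
    ← exteriorPower.finrank_eq (R := ℝ) (M := V) (n := n)]
  exact Subspace.dual_finrank_eq

theorem finrank_formsVanishingOn [FiniteDimensional ℝ V] (L : Submodule ℝ V) (n : ℕ) :
    finrank ℝ (formsVanishingOn L n) = (finrank ℝ (V ⧸ L)).choose n := by
  rw [← finrank_alternatingMap]
  let f : ((V ⧸ L) [⋀^Fin n]→ₗ[ℝ] ℝ) →ₗ[ℝ] formsVanishingOn L n :=
    { toFun := fun β => ⟨β.compLinearMap L.mkQ, compLinearMap_mkQ_mem L β⟩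
      map_add' := fun _ _ => rfl
      map_smul' := fun _ _ => rfl }
  refine (LinearEquiv.ofBijective f ⟨fun β γ h => ?_, fun α => ?_⟩).finrank_eq.symm
  · exact AlternatingMap.compLinearMap_injective L.mkQ L.mkQ_surjective (congrArg Subtype.val h)
  · obtain ⟨β, hβ⟩ := α.1.exists_eq_compLinearMap_mkQ L α.2
    exact ⟨β, Subtype.ext hβ⟩

theorem exists_linearIndependent_apply_zero_eq [FiniteDimensional ℝ V] {u : V} (hu : u ≠ 0)
    (m : ℕ) (hm : m + 1 ≤ finrank ℝ V) :
    ∃ x : Fin (m + 1) → V, LinearIndependent ℝ x ∧ x 0 = u := by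
  induction m with
  | zero =>
    have : Subsingleton (Fin (0 + 1)) := inferInstanceAs (Subsingleton (Fin 1))
    exact ⟨fun _ => u, .of_subsingleton 0 hu, rfl⟩
  | succ m ih =>
    obtain ⟨x, hx, h0⟩ := ih (by omega)
    obtain ⟨y, hy⟩ := exists_linearIndependent_snoc_of_lt_finrank hx (by omega)
    refine ⟨_, hy, ?_⟩
    rw [← h0]
    exact Fin.snoc_castSucc (α := fun _ => V) y x 0

theorem exists_alternatingMap_apply_ne_zero {n : ℕ} {x : Fin n → V}
    (hx : LinearIndependent ℝ x) : ∃ β : V [⋀^Fin n]→ₗ[ℝ] ℝ, β x ≠ 0 := by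
  let e := Pi.basisFun ℝ (Fin n)
  obtain ⟨g, hg⟩ := (e.constr ℝ x).exists_leftInverse_of_injective
    (by rw [LinearMap.ker_eq_bot]; exact e.injective_constr_of_linearIndependent hx)
  refine ⟨e.det.compLinearMap g, ?_⟩
  have : (fun i => g (x i)) = e := by
    ext1 i
    rw [← e.constr_basis ℝ x i, ← LinearMap.comp_apply, hg, LinearMap.id_apply]
  rw [AlternatingMap.compLinearMap_apply]
  change e.det (fun i => g (x i)) ≠ 0
  rw [this, e.det_self]
  exact one_ne_zero

theorem finrank_eq_finrank_ker_add {S W : Type*} [AddCommGroup S] [Module ℝ S]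
    [AddCommGroup W] [Module ℝ W] [FiniteDimensional ℝ V] [FiniteDimensional ℝ W]
    (P K : Submodule ℝ V) (f : V →ₗ[ℝ] S) (i : W →ₗ[ℝ] S) (hi : Function.Injective i)
    (hPK : P ⊓ LinearMap.ker f = K) (hmap : P.map f = LinearMap.range i) :
    finrank ℝ P = finrank ℝ K + finrank ℝ W := by
  have h := (f.domRestrict P).finrank_range_add_finrank_ker
  rw [LinearMap.range_domRestrict, hmap, LinearMap.finrank_range_of_inj hi,
    LinearMap.ker_domRestrict] at h
  have hK : K ≤ P := hPK ▸ inf_le_left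
  have : (LinearMap.ker f).comap P.subtype = K.comap P.subtype := by
    rw [← hPK, Submodule.comap_inf]; simp
  change finrank ℝ W + finrank ℝ ((LinearMap.ker f).comap P.subtype) = _ at h
  rw [this, (Submodule.comapSubtypeEquivOfLe hK).finrank_eq] at h
  omega

/-- Kernels of finitely many linear maps on a subspace `L` that jointly map `L` onto all tuples
with entries in a subspace `W`. -/
theorem finrank_ker_and_complement {U : Type*} [AddCommGroup U] [Module ℝ U]
    [FiniteDimensional ℝ V] {ι : Type*} [Fintype ι] [DecidableEq ι] [Nontrivial ι]
    (L : Submodule ℝ V) (W : Submodule ℝ U) [FiniteDimensional ℝ W] (φ : ι → V →ₗ[ℝ] U)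
    (hker : ∀ c, LinearMap.ker (φ c) ≤ L) (hmem : ∀ v ∈ L, ∀ c, φ c v ∈ W)
    (hsurj : ∀ g : ι → W, ∃ v ∈ L, ∀ c, φ c v = g c) (a : ι) :
    finrank ℝ (LinearMap.ker (φ a))
        = finrank ℝ ↥(⨅ c, LinearMap.ker (φ c)) + (Fintype.card ι - 1) * finrank ℝ W
      ∧ ∀ K : Submodule ℝ V, Disjoint (⨅ c, LinearMap.ker (φ c)) K →
        (⨅ c, LinearMap.ker (φ c)) ⊔ K = (⨅ (c : ι) (_ : c ≠ a), LinearMap.ker (φ c)) →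
        Disjoint (LinearMap.ker (φ a)) K ∧ LinearMap.ker (φ a) ⊔ K = L ∧
          finrank ℝ K = finrank ℝ W := by
  obtain ⟨d, hd⟩ := exists_ne a
  have hsingle : ∀ w : W, ∃ v ∈ L, φ a v = w ∧ ∀ c, c ≠ a → φ c v = 0 := fun w => by
    obtain ⟨v, hv, h⟩ := hsurj (Pi.single a w)
    exact ⟨v, hv, by simp [h], fun c hc => by simp [h, hc]⟩
  have hL : finrank ℝ L = finrank ℝ ↥(⨅ c, LinearMap.ker (φ c)) + finrank ℝ (ι → W) := by
    refine finrank_eq_finrank_ker_add L _ (LinearMap.pi φ) (W.subtype.compLeft ι)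
      (fun g h e => ?_) ?_ ?_
    · ext c
      exact congrFun e c
    · rw [LinearMap.ker_pi]
      exact inf_eq_right.2 ((iInf_le (fun c => LinearMap.ker (φ c)) a).trans (hker a))
    · ext g
      constructor
      · rintro ⟨v, hv, rfl⟩
        exact ⟨fun c => ⟨φ c v, hmem v hv c⟩, rfl⟩
      · rintro ⟨g, rfl⟩
        obtain ⟨v, hv, h⟩ := hsurj g
        exact ⟨v, hv, funext h⟩
  have ha : finrank ℝ L = finrank ℝ (LinearMap.ker (φ a)) + finrank ℝ W := by
    refine finrank_eq_finrank_ker_add L _ (φ a) W.subtype W.subtype_injective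
      (inf_eq_right.2 (hker a)) ?_
    rw [W.range_subtype]
    ext w
    constructor
    · rintro ⟨v, hv, rfl⟩
      exact hmem v hv a
    · intro hw
      obtain ⟨v, hv, h, -⟩ := hsingle ⟨w, hw⟩
      exact ⟨v, hv, h⟩
  have hdim : finrank ℝ (LinearMap.ker (φ a))
      = finrank ℝ ↥(⨅ c, LinearMap.ker (φ c)) + (Fintype.card ι - 1) * finrank ℝ W := by
    have hcard : Fintype.card ι = (Fintype.card ι - 1) + 1 :=
      (Nat.sub_add_cancel Fintype.card_pos).symm
    rw [finrank_pi_fintype, Finset.sum_const, Finset.card_univ, smul_eq_mul, hcard, add_mul] at hL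
    simp only [one_mul] at hL
    omega
  refine ⟨hdim, fun K hdisj hsup => ?_⟩
  have hKM : ∀ v ∈ K, ∀ c, c ≠ a → φ c v = 0 := fun v hv c hc => by
    have : v ∈ (⨅ (c : ι) (_ : c ≠ a), LinearMap.ker (φ c)) := hsup ▸ Submodule.mem_sup_right hv
    simp only [Submodule.mem_iInf, LinearMap.mem_ker] at this
    exact this c hc
  have hKL : K ≤ L := fun v hv => hker d (hKM v hv d hd)
  have hdis : Disjoint (LinearMap.ker (φ a)) K := by
    rw [Submodule.disjoint_def] at hdisj ⊢
    refine fun v hv hvK => hdisj v ?_ hvK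
    rw [Submodule.mem_iInf]
    intro c
    by_cases hc : c = a
    · exact hc ▸ hv
    · exact hKM v hvK c hc
  have hsupL : LinearMap.ker (φ a) ⊔ K = L := by
    refine le_antisymm (sup_le (hker a) hKL) fun v hv => ?_
    obtain ⟨m, -, hm, hm0⟩ := hsingle ⟨φ a v, hmem v hv a⟩
    have hmM : m ∈ (⨅ c, LinearMap.ker (φ c)) ⊔ K := by
      rw [hsup]
      simpa only [Submodule.mem_iInf, LinearMap.mem_ker] using hm0
    have hle : (⨅ c, LinearMap.ker (φ c)) ≤ LinearMap.ker (φ a) :=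
      iInf_le (fun c => LinearMap.ker (φ c)) a
    have hm' : m ∈ LinearMap.ker (φ a) ⊔ K := (sup_le_sup_right hle K : _ ≤ _) hmM
    have : v - m ∈ LinearMap.ker (φ a) := by
      rw [LinearMap.mem_ker, map_sub, hm, sub_self]
    have hadd := Submodule.add_mem _ (Submodule.mem_sup_left (T := K) this) hm'
    rwa [sub_add_cancel] at hadd
  refine ⟨hdis, hsupL, ?_⟩
  have := Submodule.finrank_sup_add_finrank_inf_eq (LinearMap.ker (φ a)) K
  rw [hsupL, hdis.eq_bot, finrank_bot] at this
  omega

end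

namespace IsPolyLag

variable {V T : Type*} [AddCommGroup V] [Module ℝ V] [AddCommGroup T] [Module ℝ T]
  {k : ℕ} {ω : V [⋀^Fin (k+1)]→ₗ[ℝ] T} {L : Submodule ℝ V}

theorem apply_cons_eq_zero (hL : IsPolyLag ω L) {v : V} (hv : v ∈ L) (x : Fin k → V) (i : Fin k)
    (hi : x i ∈ L) : ω (Fin.cons v x) = 0 :=
  (hL (ω.curryLeft v)).1 ⟨v, hv, fun _ => rfl⟩ x i hi

theorem le_finrank_quotient [FiniteDimensional ℝ V] (hL : IsPolyLag ω L) (hω : ω ≠ 0) :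
    k ≤ finrank ℝ (V ⧸ L) := by
  by_contra! hlt
  have hzero : ∀ {n : ℕ}, finrank ℝ (V ⧸ L) < n → ∀ α : V [⋀^Fin n]→ₗ[ℝ] T,
      (∀ (x : Fin n → V) (i : Fin n), x i ∈ L → α x = 0) → α = 0 := by
    intro n hn α hα
    obtain ⟨β, rfl⟩ := α.exists_eq_compLinearMap_mkQ L hα
    ext x
    refine β.map_linearDependent _ fun h => ?_
    have := h.fintype_card_le_finrank
    rw [Fintype.card_fin] at this
    omega
  refine hω (hzero (hlt.trans (Nat.lt_succ_self k)) ω fun x i hi => ?_)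
  have hcons : ∀ v ∈ L, ω.curryLeft v = 0 := fun v hv =>
    hzero hlt _ ((hL _).1 ⟨v, hv, fun _ => rfl⟩)
  have hswap : ω (x ∘ Equiv.swap 0 i) = 0 := by
    have := DFunLike.congr_fun (hcons (x i) hi) (fun j => (x ∘ Equiv.swap 0 i) j.succ)
    rw [AlternatingMap.curryLeft_apply_apply, AlternatingMap.zero_apply] at this
    rw [← this]
    congr 1
    ext j
    refine Fin.cases ?_ (fun j => ?_) j <;> simp
  rw [AlternatingMap.map_perm] at hswap
  exact (smul_eq_zero_iff_eq _).1 hswap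

variable {ι : Type*} (b : Basis ι ℝ T)

theorem curryLeft_coord_mem (hL : IsPolyLag ω L) {v : V} (hv : v ∈ L) (c : ι) :
    ((b.coord c).compAlternatingMap ω).curryLeft v ∈ formsVanishingOn L k := by
  intro x i hi
  change b.coord c (ω (Fin.cons v x)) = 0
  rw [hL.apply_cons_eq_zero hv x i hi, map_zero]

theorem exists_curryLeft_coord_eq [Fintype ι] (hL : IsPolyLag ω L)
    (g : ι → formsVanishingOn L k) :
    ∃ v ∈ L, ∀ c, ((b.coord c).compAlternatingMap ω).curryLeft v = g c := by
  classical
  obtain ⟨v, hv, h⟩ := (hL (∑ c, (LinearMap.toSpanSingleton ℝ T (b c)).compAlternatingMap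
    (g c).1)).2 (fun x i hi => by
      rw [AlternatingMap.finset_sum_apply]
      refine Finset.sum_eq_zero fun c _ => ?_
      simp [(g c).2 x i hi])
  refine ⟨v, hv, fun c => ?_⟩
  ext x
  change b.coord c (ω (Fin.cons v x)) = _
  rw [h x, AlternatingMap.finset_sum_apply, map_sum]
  simp [Finsupp.single_apply]

theorem ker_curryLeft_coord_le [Fintype ι] [FiniteDimensional ℝ V] (hL : IsPolyLag ω L)
    (hk : 1 ≤ k) (hkL : k ≤ finrank ℝ (V ⧸ L)) (a : ι) :
    LinearMap.ker ((b.coord a).compAlternatingMap ω).curryLeft ≤ L := by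
  intro u hu
  by_contra huL
  obtain ⟨m, rfl⟩ : ∃ m, k = m + 1 := ⟨k - 1, by omega⟩
  obtain ⟨x, hx, h0⟩ := exists_linearIndependent_apply_zero_eq
    (u := L.mkQ u) (by simpa using huL) m hkL
  obtain ⟨β, hβ⟩ := exists_alternatingMap_apply_ne_zero hx
  choose y hy using fun i => L.mkQ_surjective (x i)
  obtain ⟨v, -, h⟩ := hL.exists_curryLeft_coord_eq b
    (fun _ => ⟨β.compLinearMap L.mkQ, compLinearMap_mkQ_mem L β⟩)
  have hval := DFunLike.congr_fun (h a) (Fin.cons u fun j => y j.succ)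
  have hx' : (fun i => L.mkQ ((Fin.cons u fun j => y j.succ : Fin (m + 1) → V) i)) = x := by
    ext1 i
    refine Fin.cases ?_ (fun j => ?_) i
    · simp only [Fin.cons_zero, h0]
    · simp only [Fin.cons_succ, hy]
  rw [AlternatingMap.compLinearMap_apply] at hval
  change _ = β (fun i => L.mkQ ((Fin.cons u fun j => y j.succ : Fin (m + 1) → V) i)) at hval
  rw [hx'] at hval
  refine hβ (hval ▸ ?_)
  set η := (b.coord a).compAlternatingMap ω
  have hu0 : η (Fin.cons u (Fin.cons v fun j => y j.succ : Fin (m + 1) → V)) = 0 := by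
    have := DFunLike.congr_fun (LinearMap.mem_ker.1 hu) (Fin.cons v fun j => y j.succ)
    rwa [AlternatingMap.curryLeft_apply_apply] at this
  have hswap := η.map_swap (Fin.cons u (Fin.cons v fun j => y j.succ))
    (i := 0) (j := 1) (by simp)
  rw [hu0, neg_zero] at hswap
  rw [← hswap, AlternatingMap.curryLeft_apply_apply]
  congr 1
  ext j
  refine Fin.cases ?_ (fun j => Fin.cases ?_ (fun j => ?_) j) j
  · simp
  · simp
  · have : Equiv.swap (0 : Fin (m + 2)) 1 j.succ.succ = j.succ.succ :=
      Equiv.swap_apply_of_ne_of_ne (Fin.succ_ne_zero _)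
        (by rw [← Fin.succ_zero_eq_one]; exact fun e => Fin.succ_ne_zero _ (Fin.succ_injective _ e))
    simp [this]

end IsPolyLag

/-- Decomposition of the polylagrangian subspace relative to a basis of `T`:
`dim ker ω^a = dim ker ω + (nh−1)·C(N,k)`, and `L = ker ω^a ⊕ K_a` for any complement
`K_a` of `ker ω` in `⋂_{b≠a} ker ω^b`, with `dim K_a = C(N,k)`. -/
theorem stmt8 {V T : Type*} [AddCommGroup V] [Module ℝ V] [FiniteDimensional ℝ V]
    [AddCommGroup T] [Module ℝ T] [FiniteDimensional ℝ T] {k N nh : ℕ} (hk : 1 ≤ k)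
    (hn : 2 ≤ nh) (b : Basis (Fin nh) ℝ T)
    (ω : V [⋀^Fin (k+1)]→ₗ[ℝ] T) (hω : ω ≠ 0)
    (L : Submodule ℝ V) (hL : IsPolyLag ω L) (hN : Module.finrank ℝ (V ⧸ L) = N) :
    ∀ a : Fin nh,
      Module.finrank ℝ ↥(LinearMap.ker ((b.coord a).compAlternatingMap ω).curryLeft)
          = Module.finrank ℝ ↥(LinearMap.ker ω.curryLeft) + (nh - 1) * N.choose k
        ∧ ∀ K : Submodule ℝ V,
            Disjoint (LinearMap.ker ω.curryLeft) K →
            LinearMap.ker ω.curryLeft ⊔ K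
              = (⨅ (c : Fin nh) (_ : c ≠ a),
                  LinearMap.ker ((b.coord c).compAlternatingMap ω).curryLeft) →
            Disjoint (LinearMap.ker ((b.coord a).compAlternatingMap ω).curryLeft) K
              ∧ LinearMap.ker ((b.coord a).compAlternatingMap ω).curryLeft ⊔ K = L
              ∧ Module.finrank ℝ ↥K = N.choose k := by
  have hNk : k ≤ finrank ℝ (V ⧸ L) := hL.le_finrank_quotient hω
  have : Nontrivial (Fin nh) := Fin.nontrivial_iff_two_le.2 hn
  have hker : (⨅ c, LinearMap.ker ((b.coord c).compAlternatingMap ω).curryLeft)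
      = LinearMap.ker ω.curryLeft := by
    ext v
    simp only [Submodule.mem_iInf, LinearMap.mem_ker]
    constructor
    · intro h
      ext x
      refine b.ext_elem fun c => ?_
      simpa using DFunLike.congr_fun (h c) x
    · intro h c
      ext x
      simpa using congrArg (b.coord c) (DFunLike.congr_fun h x)
  have hsurj := fun g => hL.exists_curryLeft_coord_eq b g
  have hdim : finrank ℝ (formsVanishingOn L k) = N.choose k := by
    rw [finrank_formsVanishingOn, hN]
  have hfin : FiniteDimensional ℝ (formsVanishingOn L k) :=
    FiniteDimensional.of_finrank_pos (hdim ▸ Nat.choose_pos (hN ▸ hNk))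
  intro a
  have := finrank_ker_and_complement L (formsVanishingOn L k)
    (fun c => ((b.coord c).compAlternatingMap ω).curryLeft)
    (fun c => hL.ker_curryLeft_coord_le b hk hNk c)
    (fun v hv c => hL.curryLeft_coord_mem b hv c) hsurj a
  rwa [hker, hdim, Fintype.card_fin] at this
end

section
/- Let V and T̂ be finite-dimensional real vector spaces, n̂ = dim T̂, and let ω̂ be a T̂-valued polysymplectic form of rank N on V (a nondegenerate polylagrangian 2-form). Fix a basis {ê_a} of T̂ with dual basis {ê^a} and set ω^a = ⟨ê^a, ω̂⟩. Then ω̂ has uniform rank N: the 2N-forms ω^{α} := (ω¹)^{∧α₁} ∧ ⋯ ∧ (ω^{n̂})^{∧α_{n̂}} for multi-indices α ∈ ℕ^{n̂} with |α| = N are linearly independent in Λ^{2N} V*, and ω^{α} = 0 whenever |α| = N+1. -/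
open Module

/-- Wedge product of two scalar alternating forms (shuffle-sum normalization). -/
noncomputable def awedge {V : Type*} [AddCommGroup V] [Module ℝ V] {a b : ℕ}
    (f : V [⋀^Fin a]→ₗ[ℝ] ℝ) (g : V [⋀^Fin b]→ₗ[ℝ] ℝ) : V [⋀^Fin (a + b)]→ₗ[ℝ] ℝ :=
  AlternatingMap.domDomCongr finSumFinEquiv
    ((TensorProduct.lid ℝ ℝ).toLinearMap.compAlternatingMap (f.domCoprod g))

/-- The ordered wedge product `f (c 0) ∧ f (c 1) ∧ ⋯ ∧ f (c (j-1))` of `2`-forms from a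
family `f` selected by `c : Fin j → Fin nh`; for monotone `c`, this is `ω^α` for the
multi-index `α` with `α_a = #{i | c i = a}`. -/
noncomputable def wprod {V : Type*} [AddCommGroup V] [Module ℝ V] {nh : ℕ}
    (f : Fin nh → (V [⋀^Fin 2]→ₗ[ℝ] ℝ)) : (j : ℕ) → (Fin j → Fin nh) → V [⋀^Fin (2 * j)]→ₗ[ℝ] ℝ
  | 0, _ => AlternatingMap.constOfIsEmpty ℝ V (Fin 0) 1
  | j + 1, c => awedge (wprod f j (fun i => c i.castSucc)) (f (c (Fin.last j)))

/-- The bijection `(i, b) ↦ 2 * i + b`. -/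
def pairEquiv (j : ℕ) : Fin j × Fin 2 ≃ Fin (2 * j) :=
  finProdFinEquiv.trans (finCongr (mul_comm j 2))

theorem MultilinearMap.alternatization_domDomCongr {R M P ι κ : Type*} [CommRing R]
    [AddCommGroup M] [Module R M] [AddCommGroup P] [Module R P]
    [Fintype ι] [DecidableEq ι] [Fintype κ] [DecidableEq κ]
    (e : ι ≃ κ) (m : MultilinearMap R (fun _ : ι => M) P) :
    MultilinearMap.alternatization (m.domDomCongr e) =
      (MultilinearMap.alternatization m).domDomCongr e := by
  ext x
  simp only [MultilinearMap.alternatization_apply, AlternatingMap.domDomCongr_apply,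
    MultilinearMap.domDomCongr_apply]
  refine (Fintype.sum_equiv e.permCongr _ _ fun π => ?_).symm
  rw [Equiv.Perm.sign_permCongr]
  simp

/-- A wedge product of `2`-forms is the alternatization of the corresponding tensor product,
each factor being halved. -/
theorem exists_wprod_eq_alternatization {V : Type*} [AddCommGroup V] [Module ℝ V] {nh : ℕ}
    (f : Fin nh → (V [⋀^Fin 2]→ₗ[ℝ] ℝ)) : ∀ (j : ℕ) (c : Fin j → Fin nh),
    ∃ P : MultilinearMap ℝ (fun _ : Fin (2 * j) => V) ℝ,
      wprod f j c = MultilinearMap.alternatization P ∧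
        ∀ x, P x = ∏ i, 2⁻¹ * f (c i) fun b => x (pairEquiv j (i, b))
  | 0, c => by
    have : IsEmpty (Fin (2 * 0)) := Fin.isEmpty
    refine ⟨MultilinearMap.constOfIsEmpty ℝ _ 1, ?_, fun x => by simp⟩
    ext x
    rw [MultilinearMap.alternatization_apply,
      Fintype.sum_eq_single 1 fun π hπ => (hπ (Equiv.ext fun i => Fin.elim0 i)).elim]
    simp [wprod]
  | j + 1, c => by
    obtain ⟨P, hP, hPx⟩ := exists_wprod_eq_alternatization f j fun i => c i.castSucc
    let Q : MultilinearMap ℝ (fun _ : Fin 2 => V) ℝ :=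
      (2⁻¹ : ℝ) • (f (c (Fin.last j))).toMultilinearMap
    have hQ : MultilinearMap.alternatization Q = f (c (Fin.last j)) := by
      rw [show Q = ((2⁻¹ : ℝ) • f (c (Fin.last j)) : V [⋀^Fin 2]→ₗ[ℝ] ℝ).toMultilinearMap from rfl,
        AlternatingMap.coe_alternatization]
      ext x
      simp
    refine ⟨((TensorProduct.lid ℝ ℝ).toLinearMap.compMultilinearMap
      (P.domCoprod Q)).domDomCongr finSumFinEquiv, ?_, fun x => ?_⟩
    · rw [MultilinearMap.alternatization_domDomCongr, LinearMap.compMultilinearMap_alternatization,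
        MultilinearMap.domCoprod_alternization, hQ, ← hP]
      rfl
    · rw [Fin.prod_univ_castSucc]
      simp only [MultilinearMap.domDomCongr_apply, LinearMap.compMultilinearMap_apply,
        MultilinearMap.domCoprod_apply, LinearEquiv.coe_coe, TensorProduct.lid_tmul, smul_eq_mul,
        hPx, Q, smul_apply, AlternatingMap.coe_multilinearMap]
      congr 4
      funext b
      congr 1
      ext
      exact (Fin.val_natAdd (2 * j) b).trans (add_comm _ _)

/-- The wedge product of `2`-forms as a signed sum over all arrangements of the arguments. -/
theorem wprod_apply_comp_symm {V : Type*} [AddCommGroup V] [Module ℝ V] {nh : ℕ}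
    (f : Fin nh → (V [⋀^Fin 2]→ₗ[ℝ] ℝ)) (j : ℕ) (c : Fin j → Fin nh) (x : Fin j × Fin 2 → V) :
    wprod f j c (x ∘ (pairEquiv j).symm) =
      ∑ π : Equiv.Perm (Fin j × Fin 2), Equiv.Perm.sign π •
        ∏ i, 2⁻¹ * f (c i) fun b => x (π (i, b)) := by
  obtain ⟨P, hP, hPx⟩ := exists_wprod_eq_alternatization f j c
  rw [hP, MultilinearMap.alternatization_apply]
  refine (Fintype.sum_equiv (pairEquiv j).permCongr _ _ fun π => ?_).symm
  rw [Equiv.Perm.sign_permCongr]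
  simp [hPx]

/-- A product of more than `N` two-forms vanishing on a subspace of codimension `N` is zero. -/
theorem wprod_eq_zero_of_isotropic {V : Type*} [AddCommGroup V] [Module ℝ V]
    [FiniteDimensional ℝ V] {nh : ℕ} (f : Fin nh → (V [⋀^Fin 2]→ₗ[ℝ] ℝ)) (L : Submodule ℝ V)
    (hf : ∀ a, ∀ x : Fin 2 → V, (∀ b, x b ∈ L) → f a x = 0)
    {j : ℕ} (hj : Module.finrank ℝ (V ⧸ L) < j) (c : Fin j → Fin nh) : wprod f j c = 0 := by
  let B := (Module.finBasis ℝ L).sumQuot (Module.finBasis ℝ (V ⧸ L))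
  refine Module.Basis.ext_alternating B fun v hv => ?_
  have hx : (fun i => B (v i)) = (B ∘ v ∘ pairEquiv j) ∘ (pairEquiv j).symm := by
    ext i
    simp
  rw [hx, wprod_apply_comp_symm, AlternatingMap.zero_apply]
  refine Finset.sum_eq_zero fun π _ => ?_
  suffices h : ∏ i, 2⁻¹ * f (c i) (fun b => (B ∘ v ∘ pairEquiv j) (π (i, b))) = 0 by
    rw [h, smul_zero]
  by_contra hne
  have key : ∀ i, ∃ (b : Fin 2) (k : Fin (Module.finrank ℝ (V ⧸ L))),
      v (pairEquiv j (π (i, b))) = Sum.inr k := by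
    intro i
    by_contra! hi
    refine hne (Finset.prod_eq_zero (Finset.mem_univ i) ?_)
    rw [hf, mul_zero]
    intro b
    rcases hk : v (pairEquiv j (π (i, b))) with k | k
    · simp [hk, B]
    · exact (hi b k hk).elim
  choose b k hk using key
  have hinj : Function.Injective k := by
    intro i i' h
    have := π.injective ((pairEquiv j).injective (hv ((hk i).trans (h ▸ (hk i').symm))))
    exact congrArg Prod.fst this
  have := Fintype.card_le_of_injective k hinj
  simp at this
  omega

/-- A permutation of `Fin N × Fin 2` for which every pair contains an odd element, and every even
element shares its pair with its odd neighbour, permutes the pairs. -/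
theorem Equiv.Perm.exists_eq_prodCongrLeft_mul_prodCongrRight {N : ℕ}
    (π : Equiv.Perm (Fin N × Fin 2)) (h₁ : ∀ i, ∃ b, (π (i, b)).2 = 1)
    (h₂ : ∀ i b b', (π (i, b)).2 = 0 → (π (i, b')).2 = 1 → (π (i, b)).1 = (π (i, b')).1) :
    ∃ (σ : Equiv.Perm (Fin N)) (τ : Fin N → Equiv.Perm (Fin 2)),
      π = Equiv.prodCongrLeft (fun _ => σ) * Equiv.prodCongrRight τ := by
  choose β hβ using h₁
  have hinj : Function.Injective fun i => (π (i, β i)).1 := by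
    intro i i' h
    exact congrArg Prod.fst (π.injective (Prod.ext h ((hβ i).trans (hβ i').symm)))
  have hbij := Finite.injective_iff_bijective.mp hinj
  have hfst : ∀ i b, (π (i, b)).1 = (π (i, β i)).1 := by
    intro i b
    by_cases hb : (π (i, b)).2 = 0
    · exact h₂ i b (β i) hb (hβ i)
    · have hb1 : (π (i, b)).2 = 1 := by omega
      obtain ⟨i', hi'⟩ := hbij.2 (π (i, b)).1
      have := π.injective (Prod.ext hi' ((hβ i').trans hb1.symm))
      obtain ⟨rfl, h⟩ := Prod.mk.inj this
      rw [h]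
  have hsnd : ∀ i, Function.Injective fun b => (π (i, b)).2 := by
    intro i b b' h
    exact congrArg Prod.snd
      (π.injective (Prod.ext ((hfst i b).trans (hfst i b').symm) h))
  refine ⟨Equiv.ofBijective _ hbij,
    fun i => Equiv.ofBijective _ (Finite.injective_iff_bijective.mp (hsnd i)), ?_⟩
  ext1 ⟨i, b⟩
  exact Prod.ext (hfst i b) rfl

theorem Equiv.Perm.sign_prodCongrLeft_mul_prodCongrRight {N : ℕ} (σ : Equiv.Perm (Fin N))
    (τ : Fin N → Equiv.Perm (Fin 2)) :
    Equiv.Perm.sign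
        (Equiv.prodCongrLeft (fun _ => σ) * Equiv.prodCongrRight τ : Equiv.Perm (Fin N × Fin 2)) =
      ∏ i, Equiv.Perm.sign (τ i) := by
  rw [Equiv.Perm.sign_mul, Equiv.Perm.sign_prodCongrLeft, Equiv.Perm.sign_prodCongrRight]
  simp

/-- If the `2`-forms vanish on the `l i`, and `l i` pairs to `1` with `e i` under the `a i`-th form and
to `0` with every other `e k` or under every other form, then each term of the expansion of a product of `N` such forms on `(l 0, e 0, l 1, e 1, …)` is nonnegative, and it
vanishes unless the forms are a permutation of those selected by `a`. -/
theorem sign_smul_prod_nonneg {V : Type*} [AddCommGroup V] [Module ℝ V] {N nh : ℕ}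
    (f : Fin nh → (V [⋀^Fin 2]→ₗ[ℝ] ℝ)) (a c : Fin N → Fin nh) (l e : Fin N → V)
    (hll : ∀ d i k, f d ![l i, l k] = 0)
    (hle : ∀ d i k, f d ![l i, e k] = if i = k ∧ a i = d then 1 else 0)
    (π : Equiv.Perm (Fin N × Fin 2)) :
    let t := Equiv.Perm.sign π •
      ∏ i, 2⁻¹ * f (c i) fun b => (fun p : Fin N × Fin 2 => ![l p.1, e p.1] p.2) (π (i, b))
    0 ≤ t ∧ (t ≠ 0 → ∃ σ : Equiv.Perm (Fin N), c = a ∘ σ) := by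
  intro t
  by_cases ht : t = 0
  · simp [ht]
  have hfac : ∀ i, f (c i)
      (fun b => (fun p : Fin N × Fin 2 => ![l p.1, e p.1] p.2) (π (i, b))) ≠ 0 := by
    intro i h
    refine ht ?_
    simp only [t]
    rw [Finset.prod_eq_zero (Finset.mem_univ i) (by rw [h, mul_zero]), smul_zero]
  have hswap : ∀ d (u v : V), f d ![v, u] = - f d ![u, v] := by
    intro d u v
    rw [← (f d).map_swap ![u, v] (Fin.zero_ne_one)]
    congr 1
    ext b
    fin_cases b <;> simp
  have hpair : ∀ i, (fun b => (fun p : Fin N × Fin 2 => ![l p.1, e p.1] p.2) (π (i, b))) =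
      ![![l (π (i, 0)).1, e (π (i, 0)).1] (π (i, 0)).2,
        ![l (π (i, 1)).1, e (π (i, 1)).1] (π (i, 1)).2] := by
    intro i
    ext b
    fin_cases b <;> rfl
  have h₁ : ∀ i, ∃ b, (π (i, b)).2 = 1 := by
    intro i
    by_contra! h
    have h0 : ∀ b, (π (i, b)).2 = 0 := fun b => by have := h b; omega
    refine hfac i ?_
    rw [hpair, h0, h0]
    exact hll _ _ _
  have h₂ : ∀ i b b', (π (i, b)).2 = 0 → (π (i, b')).2 = 1 → (π (i, b)).1 = (π (i, b')).1 := by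
    intro i b b' hb hb'
    have hne := hfac i
    rw [hpair] at hne
    by_contra hik
    refine hne ?_
    fin_cases b <;> fin_cases b' <;> simp only [Fin.zero_eta, Fin.mk_one] at hb hb' hik ⊢
    · omega
    · rw [hb, hb']
      exact (hle _ _ _).trans (if_neg fun h => hik h.1)
    · rw [hb, hb', hswap]
      exact neg_eq_zero.mpr ((hle _ _ _).trans (if_neg fun h => hik h.1))
    · omega
  obtain ⟨σ, τ, rfl⟩ := Equiv.Perm.exists_eq_prodCongrLeft_mul_prodCongrRight π h₁ h₂
  have hval : ∀ i, f (c i) (fun b => (fun p : Fin N × Fin 2 => ![l p.1, e p.1] p.2)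
      ((Equiv.prodCongrLeft (fun _ => σ) * Equiv.prodCongrRight τ : Equiv.Perm (Fin N × Fin 2))
        (i, b))) =
      Equiv.Perm.sign (τ i) • if a (σ i) = c i then (1 : ℝ) else 0 := by
    intro i
    have := (f (c i)).map_perm ![l (σ i), e (σ i)] (τ i)
    rw [hle] at this
    simpa [Function.comp_def] using this
  have hac : ∀ i, a (σ i) = c i := by
    intro i
    by_contra h
    exact hfac i (by rw [hval, if_neg h, smul_zero])
  refine ⟨?_, fun _ => ⟨σ, funext fun i => (hac i).symm⟩⟩
  simp only [t, hval, Equiv.Perm.sign_prodCongrLeft_mul_prodCongrRight, if_pos (hac _)]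
  simp only [Units.smul_def, zsmul_eq_mul, Units.coe_prod, Int.cast_prod, mul_one,
    ← Finset.prod_mul_distrib]
  refine Finset.prod_nonneg fun i _ => ?_
  rcases Int.units_eq_one_or (Equiv.Perm.sign (τ i)) with h | h <;> rw [h] <;> norm_num

/-- Products of `N` two-forms indexed by monotone families are linearly independent as soon as the
forms admit vectors `e k` and pairwise orthogonal vectors `l i j` such that `l i j` pairs to `1` with
`e i` under the `j`-th form, all other pairings being `0`. -/
theorem linearIndependent_wprod {V : Type*} [AddCommGroup V] [Module ℝ V] {N nh : ℕ}
    (f : Fin nh → (V [⋀^Fin 2]→ₗ[ℝ] ℝ)) (l : Fin N → Fin nh → V) (e : Fin N → V)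
    (hll : ∀ d i j k m, f d ![l i j, l k m] = 0)
    (hle : ∀ d i j k, f d ![l i j, e k] = if i = k ∧ j = d then 1 else 0) :
    LinearIndependent ℝ (fun c : {c : Fin N → Fin nh // Monotone c} => wprod f N c.1) := by
  rw [Fintype.linearIndependent_iff]
  intro g hg a
  let x : Fin N × Fin 2 → V := fun p => ![l p.1 (a.1 p.1), e p.1] p.2
  have hterm := fun c : Fin N → Fin nh => sign_smul_prod_nonneg f a.1 c (fun i => l i (a.1 i)) e
    (fun d i k => hll d i _ k _) (fun d i k => hle d i _ k)
  have hoff : ∀ c : {c : Fin N → Fin nh // Monotone c}, c ≠ a →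
      wprod f N c.1 (x ∘ (pairEquiv N).symm) = 0 := by
    intro c hca
    rw [wprod_apply_comp_symm]
    refine Finset.sum_eq_zero fun π _ => ?_
    by_contra hne
    obtain ⟨σ, hσ⟩ := (hterm c.1 π).2 hne
    refine hca (Subtype.ext (hσ.trans ?_))
    exact Tuple.unique_monotone (σ := σ) (τ := 1) (hσ ▸ c.2) a.2
  have hdiag : 0 < wprod f N a.1 (x ∘ (pairEquiv N).symm) := by
    rw [wprod_apply_comp_symm]
    refine Finset.sum_pos' (fun π _ => (hterm a.1 π).1) ⟨1, Finset.mem_univ _, ?_⟩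
    rw [Equiv.Perm.sign_one, one_smul]
    refine Finset.prod_pos fun i _ => ?_
    have hx : (fun b => x ((1 : Equiv.Perm (Fin N × Fin 2)) (i, b))) = ![l i (a.1 i), e i] := rfl
    rw [hx, hle]
    norm_num
  let ev : (V [⋀^Fin (2 * N)]→ₗ[ℝ] ℝ) →ₗ[ℝ] ℝ :=
    { toFun := fun φ => φ (x ∘ (pairEquiv N).symm)
      map_add' := fun _ _ => rfl
      map_smul' := fun _ _ => rfl }
  have := congrArg ev hg
  simp only [map_sum, map_smul, map_zero] at this
  have hev : ∀ c, c ≠ a → g c • ev (wprod f N c.1) = 0 := fun c hc => by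
    rw [show ev (wprod f N c.1) = 0 from hoff c hc, smul_zero]
  rw [Fintype.sum_eq_single a hev] at this
  exact (smul_eq_zero.mp this).resolve_right hdiag.ne'

/-- A polylagrangian subspace is isotropic. -/
theorem IsPolyLag.apply_eq_zero {V T : Type*} [AddCommGroup V] [Module ℝ V] [AddCommGroup T]
    [Module ℝ T] {ω : V [⋀^Fin 2]→ₗ[ℝ] T} {L : Submodule ℝ V} (hL : IsPolyLag ω L)
    {x : Fin 2 → V} (hx : ∀ b, x b ∈ L) : ω x = 0 := by
  have h := (hL (ω.curryLeft (x 0))).mp ⟨x 0, hx 0, fun _ => rfl⟩ (Fin.tail x) 0 (hx 1)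
  rw [← Fin.cons_self_tail x]
  exact h

/-- Every `T`-valued covector annihilating a polylagrangian subspace is a contraction of `ω` with
an element of that subspace. -/
theorem IsPolyLag.exists_mem_apply_eq {V T : Type*} [AddCommGroup V] [Module ℝ V] [AddCommGroup T]
    [Module ℝ T] {ω : V [⋀^Fin 2]→ₗ[ℝ] T} {L : Submodule ℝ V} (hL : IsPolyLag ω L)
    (φ : V →ₗ[ℝ] T) (hφ : ∀ v ∈ L, φ v = 0) : ∃ u ∈ L, ∀ v, ω ![u, v] = φ v := by
  obtain ⟨u, hu, h⟩ := (hL (AlternatingMap.ofSubsingleton ℝ V T 0 φ)).mpr fun x i hi => by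
    rw [Subsingleton.elim i 0] at hi
    exact hφ _ hi
  exact ⟨u, hu, fun v => h ![v]⟩

/-- A polysymplectic form (nondegenerate polylagrangian `2`-form) of rank `N` has
uniform rank `N`: for any basis `b` of `T`, with `ω^a = ⟨b^a, ω⟩`, the products
`ω^α` with `|α| = N` (indexed by monotone `c : Fin N → Fin nh`) are linearly
independent, and all products with `|α| = N+1` vanish. -/
theorem stmt18 {V T : Type*} [AddCommGroup V] [Module ℝ V] [FiniteDimensional ℝ V]
    [AddCommGroup T] [Module ℝ T] [FiniteDimensional ℝ T] {N nh : ℕ}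
    (ω : V [⋀^Fin 2]→ₗ[ℝ] T) (hnd : LinearMap.ker ω.curryLeft = ⊥)
    (L : Submodule ℝ V) (hL : IsPolyLag ω L) (hN : Module.finrank ℝ (V ⧸ L) = N)
    (b : Basis (Fin nh) ℝ T) :
    LinearIndependent ℝ
      (fun c : {c : Fin N → Fin nh // Monotone c} =>
        wprod (fun a => (b.coord a).compAlternatingMap ω) N c.1)
      ∧ ∀ c : Fin (N + 1) → Fin nh, Monotone c →
          wprod (fun a => (b.coord a).compAlternatingMap ω) (N + 1) c = 0 := by
  have hiso : ∀ a, ∀ x : Fin 2 → V, (∀ i, x i ∈ L) → (b.coord a).compAlternatingMap ω x = 0 := by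
    intro a x hx
    rw [LinearMap.compAlternatingMap_apply, hL.apply_eq_zero hx, map_zero]
  refine ⟨?_, fun c _ => wprod_eq_zero_of_isotropic _ L hiso (hN ▸ Nat.lt_succ_self N) c⟩
  let q := Module.finBasisOfFinrankEq ℝ (V ⧸ L) hN
  have hl : ∀ (i : Fin N) (a : Fin nh), ∃ u ∈ L, ∀ v, ω ![u, v] = q.coord i (L.mkQ v) • b a := by
    intro i a
    refine hL.exists_mem_apply_eq (((q.coord i).comp L.mkQ).smulRight (b a)) fun v hv => ?_
    simp [(Submodule.Quotient.mk_eq_zero L).mpr hv]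
  choose l hlL hl using hl
  choose e he using fun k => L.mkQ_surjective (q k)
  refine linearIndependent_wprod _ l e (fun d i j k m => hiso d _ ?_) fun d i j k => ?_
  · simp [Fin.forall_fin_two, hlL]
  · rw [LinearMap.compAlternatingMap_apply, hl, he]
    by_cases h : i = k <;> simp [h, Finsupp.single_apply, eq_comm]
end

section
/- Let V and T̂ be finite-dimensional real vector spaces and let ω̂ be a T̂-valued 2-form on V of uniform rank N, meaning that for every nonzero t* ∈ T̂*, the scalar 2-form ω_{t*} = ⟨t*, ω̂⟩ satisfies ω_{t*}^{∧N} ≠ 0 and ω_{t*}^{∧(N+1)} = 0. Then for any nonzero t₁*, t₂* ∈ T̂*, the kernel of ω_{t₁*} is isotropic with respect to ω_{t₂*}: ω_{t₂*}(u, v) = 0 for all u, v ∈ ker ω_{t₁*}. -/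
open Module

/-- The `j`-th wedge power of a scalar `2`-form. -/
noncomputable def wpow {V : Type*} [AddCommGroup V] [Module ℝ V]
    (f : V [⋀^Fin 2]→ₗ[ℝ] ℝ) : (j : ℕ) → V [⋀^Fin (2 * j)]→ₗ[ℝ] ℝ
  | 0 => AlternatingMap.constOfIsEmpty ℝ V (Fin 0) 1
  | j + 1 => awedge (wpow f j) f

open Equiv in
/-- The wedge product as a signed sum over all permutations. -/
theorem factorial_mul_awedge_apply {V : Type*} [AddCommGroup V] [Module ℝ V] {a b : ℕ}
    (f : V [⋀^Fin a]→ₗ[ℝ] ℝ) (g : V [⋀^Fin b]→ₗ[ℝ] ℝ) (x : Fin (a + b) → V) :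
    ((a.factorial * b.factorial : ℕ) : ℝ) * awedge f g x =
      ∑ σ : Perm (Fin a ⊕ Fin b), ((Perm.sign σ : ℤ) : ℝ) *
        (f (fun i => x (finSumFinEquiv (σ (Sum.inl i)))) *
          g (fun i => x (finSumFinEquiv (σ (Sum.inr i))))) := by
  have h := congrArg (TensorProduct.lid ℝ ℝ) (DFunLike.congr_fun
    (MultilinearMap.domCoprod_alternization_eq f g) (fun i => x (finSumFinEquiv i)))
  rw [MultilinearMap.alternatization_apply, map_sum] at h
  simp only [Fintype.card_fin, AlternatingMap.smul_apply, map_nsmul] at h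
  rw [nsmul_eq_mul] at h
  refine Eq.trans ?_ (h.symm.trans (Finset.sum_congr rfl fun σ _ => ?_))
  · rfl
  · rw [Units.smul_def, map_zsmul]
    simp

/-- The signed sum over permutations computing `(f ∧ g) ∧ h` up to a positive factor. -/
noncomputable def tripleSum {V : Type*} [AddCommGroup V] [Module ℝ V] {a b c : ℕ}
    (f : V [⋀^Fin a]→ₗ[ℝ] ℝ) (g : V [⋀^Fin b]→ₗ[ℝ] ℝ) (h : V [⋀^Fin c]→ₗ[ℝ] ℝ)
    (x : Fin (a + b + c) → V) : ℝ :=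
  ∑ σ : Equiv.Perm (Fin (a + b) ⊕ Fin c), ((Equiv.Perm.sign σ : ℤ) : ℝ) *
    (f (fun i => x (finSumFinEquiv (σ (Sum.inl (finSumFinEquiv (Sum.inl i)))))) *
      g (fun i => x (finSumFinEquiv (σ (Sum.inl (finSumFinEquiv (Sum.inr i)))))) *
      h (fun i => x (finSumFinEquiv (σ (Sum.inr i)))))

open Equiv in
theorem factorial_mul_awedge_awedge_apply {V : Type*} [AddCommGroup V] [Module ℝ V] {a b c : ℕ}
    (f : V [⋀^Fin a]→ₗ[ℝ] ℝ) (g : V [⋀^Fin b]→ₗ[ℝ] ℝ) (h : V [⋀^Fin c]→ₗ[ℝ] ℝ)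
    (x : Fin (a + b + c) → V) :
    ((a.factorial * b.factorial : ℕ) : ℝ) * ((((a + b).factorial * c.factorial : ℕ) : ℝ) *
      awedge (awedge f g) h x) =
      (Fintype.card (Perm (Fin a ⊕ Fin b)) : ℝ) * tripleSum f g h x := by
  rw [factorial_mul_awedge_apply, Finset.mul_sum]
  have key : ∀ σ : Perm (Fin (a + b) ⊕ Fin c),
      ((a.factorial * b.factorial : ℕ) : ℝ) * (((Perm.sign σ : ℤ) : ℝ) *
        (awedge f g (fun i => x (finSumFinEquiv (σ (Sum.inl i)))) *
          h (fun i => x (finSumFinEquiv (σ (Sum.inr i)))))) =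
      ∑ τ : Perm (Fin a ⊕ Fin b), ((Perm.sign σ : ℤ) : ℝ) * (((Perm.sign τ : ℤ) : ℝ) *
        (f (fun i => x (finSumFinEquiv (σ (Sum.inl (finSumFinEquiv (τ (Sum.inl i))))))) *
          g (fun i => x (finSumFinEquiv (σ (Sum.inl (finSumFinEquiv (τ (Sum.inr i)))))))) *
        h (fun i => x (finSumFinEquiv (σ (Sum.inr i))))) := by
    intro σ
    rw [← Finset.mul_sum, ← Finset.sum_mul, ← factorial_mul_awedge_apply f g
      (fun i => x (finSumFinEquiv (σ (Sum.inl i))))]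
    ring
  rw [Finset.sum_congr rfl fun σ _ => key σ, Finset.sum_comm, ← nsmul_eq_mul,
    ← Finset.card_univ, ← Finset.sum_const]
  refine Finset.sum_congr rfl fun τ _ => ?_
  refine Eq.trans ?_ (Equiv.sum_comp
    (Equiv.mulRight (Perm.sumCongr (finSumFinEquiv.permCongr τ) (1 : Perm (Fin c)))) _)
  refine Finset.sum_congr rfl fun σ _ => ?_
  simp [Perm.sign_mul, mul_assoc]

open Equiv in
theorem tripleSum_right_comm {V : Type*} [AddCommGroup V] [Module ℝ V] {a : ℕ}
    (f : V [⋀^Fin a]→ₗ[ℝ] ℝ) (g h : V [⋀^Fin 2]→ₗ[ℝ] ℝ) (x : Fin (a + 2 + 2) → V) :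
    tripleSum f g h x = tripleSum f h g x := by
  let π : Perm (Fin (a + 2) ⊕ Fin 2) :=
    (Equiv.sumCongr finSumFinEquiv (Equiv.refl (Fin 2))).permCongr
      ((Equiv.sumAssoc (Fin a) (Fin 2) (Fin 2)).symm.permCongr
        (Perm.sumCongr 1 (Equiv.sumComm (Fin 2) (Fin 2))))
  have hπ : Perm.sign π = 1 := by
    simp only [π, Perm.sign_permCongr, Perm.sign_sumCongr]
    rw [Perm.sign_one, one_mul]
    decide
  rw [tripleSum, tripleSum, ← Equiv.sum_comp (Equiv.mulRight π)]
  refine Finset.sum_congr rfl fun σ _ => ?_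
  simp only [Equiv.coe_mulRight, Perm.sign_mul, hπ, mul_one]
  rw [mul_right_comm]
  simp [π]

/-- Two-forms commute under right wedge multiplication. -/
theorem awedge_right_comm {V : Type*} [AddCommGroup V] [Module ℝ V] {a : ℕ}
    (f : V [⋀^Fin a]→ₗ[ℝ] ℝ) (g h : V [⋀^Fin 2]→ₗ[ℝ] ℝ) :
    awedge (awedge f g) h = awedge (awedge f h) g := by
  ext x
  have h₁ := factorial_mul_awedge_awedge_apply f g h x
  rw [tripleSum_right_comm, ← factorial_mul_awedge_awedge_apply f h g x] at h₁
  exact mul_left_cancel₀ (by positivity) (mul_left_cancel₀ (by positivity) h₁)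

theorem awedge_smul_left {V : Type*} [AddCommGroup V] [Module ℝ V] {a b : ℕ} (r : ℝ)
    (f : V [⋀^Fin a]→ₗ[ℝ] ℝ) (g : V [⋀^Fin b]→ₗ[ℝ] ℝ) :
    awedge (r • f) g = r • awedge f g := by
  ext x
  refine mul_left_cancel₀ (a := ((a.factorial * b.factorial : ℕ) : ℝ)) (by positivity) ?_
  rw [AlternatingMap.smul_apply, smul_eq_mul, mul_left_comm, factorial_mul_awedge_apply,
    factorial_mul_awedge_apply, Finset.mul_sum]
  refine Finset.sum_congr rfl fun σ _ => ?_
  simp only [AlternatingMap.smul_apply, smul_eq_mul]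
  ring

/-- The Leibniz rule for the wedge product. -/
theorem hasDerivAt_awedge {V : Type*} [AddCommGroup V] [Module ℝ V] {a b : ℕ}
    {F : ℝ → V [⋀^Fin a]→ₗ[ℝ] ℝ} {G : ℝ → V [⋀^Fin b]→ₗ[ℝ] ℝ}
    {F' : V [⋀^Fin a]→ₗ[ℝ] ℝ} {G' : V [⋀^Fin b]→ₗ[ℝ] ℝ} {s : ℝ}
    (hF : ∀ x, HasDerivAt (fun t => F t x) (F' x) s)
    (hG : ∀ x, HasDerivAt (fun t => G t x) (G' x) s) (x : Fin (a + b) → V) :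
    HasDerivAt (fun t => awedge (F t) (G t) x) ((awedge F' (G s) + awedge (F s) G') x) s := by
  have hc : ((a.factorial * b.factorial : ℕ) : ℝ) ≠ 0 := by positivity
  have hsum := HasDerivAt.fun_sum (u := Finset.univ) fun (σ : Equiv.Perm (Fin a ⊕ Fin b)) _ =>
    ((hF fun i => x (finSumFinEquiv (σ (Sum.inl i)))).mul
      (hG fun i => x (finSumFinEquiv (σ (Sum.inr i))))).const_mul
        ((Equiv.Perm.sign σ : ℤ) : ℝ)
  convert! hsum.const_mul ((a.factorial * b.factorial : ℕ) : ℝ)⁻¹ using 1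
  · funext t
    rw [eq_inv_mul_iff_mul_eq₀ hc]
    exact factorial_mul_awedge_apply _ _ _
  · rw [eq_inv_mul_iff_mul_eq₀ hc, AlternatingMap.add_apply, mul_add,
      factorial_mul_awedge_apply, factorial_mul_awedge_apply, ← Finset.sum_add_distrib]
    simp only [mul_add]

/-- The derivative of the wedge power `(f + s g)^(j + 1)` at `s = 0`. -/
theorem hasDerivAt_wpow_succ {V : Type*} [AddCommGroup V] [Module ℝ V]
    (f g : V [⋀^Fin 2]→ₗ[ℝ] ℝ) (j : ℕ) (x : Fin (2 * (j + 1)) → V) :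
    HasDerivAt (fun s : ℝ => wpow (f + s • g) (j + 1) x)
      ((((j + 1 : ℕ) : ℝ) • awedge (wpow f j) g) x) 0 := by
  have hlin : ∀ y, HasDerivAt (fun s : ℝ => (f + s • g) y) (g y) 0 := fun y => by
    simpa using ((hasDerivAt_id (0 : ℝ)).mul_const (g y)).const_add (f y)
  induction j with
  | zero =>
    have h := hasDerivAt_awedge (F := fun s => wpow (f + s • g) 0) (F' := 0)
      (fun y => hasDerivAt_const _ _) hlin x
    have h₀ : awedge (0 : V [⋀^Fin (2 * 0)]→ₗ[ℝ] ℝ) (f + (0 : ℝ) • g) = 0 := by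
      simpa using awedge_smul_left 0 (0 : V [⋀^Fin (2 * 0)]→ₗ[ℝ] ℝ) (f + (0 : ℝ) • g)
    rw [h₀] at h
    rw [zero_add] at h
    simpa only [zero_add, Nat.cast_one, one_smul] using! h
  | succ j ih =>
    have h := hasDerivAt_awedge ih hlin x
    convert! h using 1
    rw [awedge_smul_left, zero_smul, add_zero, awedge_right_comm]
    change _ = ((((j + 1 : ℕ) : ℝ) • awedge (wpow f (j + 1)) g) + awedge (wpow f (j + 1)) g) x
    simp only [AlternatingMap.add_apply, AlternatingMap.smul_apply, smul_eq_mul]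
    push_cast
    ring

/-- A vector annihilated by both factors is annihilated by their wedge product. -/
theorem awedge_apply_eq_zero_of_forall {V : Type*} [AddCommGroup V] [Module ℝ V] {a b : ℕ}
    {f : V [⋀^Fin a]→ₗ[ℝ] ℝ} {g : V [⋀^Fin b]→ₗ[ℝ] ℝ} {u : V}
    (hf : ∀ x i, x i = u → f x = 0) (hg : ∀ x i, x i = u → g x = 0)
    (x : Fin (a + b) → V) (i : Fin (a + b)) (hx : x i = u) : awedge f g x = 0 := by
  have hc : ((a.factorial * b.factorial : ℕ) : ℝ) ≠ 0 := by positivity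
  refine (mul_eq_zero.mp ?_).resolve_left hc
  rw [factorial_mul_awedge_apply]
  refine Finset.sum_eq_zero fun σ _ => ?_
  rcases h : σ.symm (finSumFinEquiv.symm i) with k | k
  · rw [hf _ k (by rw [← h]; simpa using hx)]
    simp
  · rw [hg _ k (by rw [← h]; simpa using hx)]
    simp

theorem wpow_apply_eq_zero_of_forall {V : Type*} [AddCommGroup V] [Module ℝ V]
    {f : V [⋀^Fin 2]→ₗ[ℝ] ℝ} {u : V} (hf : ∀ x i, x i = u → f x = 0) (j : ℕ) :
    ∀ (x : Fin (2 * j) → V) (i : Fin (2 * j)), x i = u → wpow f j x = 0 := by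
  induction j with
  | zero => exact fun _ i => i.elim0
  | succ j ih => exact awedge_apply_eq_zero_of_forall ih hf

open Equiv in
/-- If `f ∧ g = 0` and all the vectors `y i` are annihilated by `f`, then
`f x * g y = 0` for every `x`. -/
theorem mul_eq_zero_of_awedge_eq_zero {V : Type*} [AddCommGroup V] [Module ℝ V] {a b : ℕ}
    {f : V [⋀^Fin a]→ₗ[ℝ] ℝ} {g : V [⋀^Fin b]→ₗ[ℝ] ℝ} (hfg : awedge f g = 0)
    {y : Fin b → V} (hf : ∀ k x i, x i = y k → f x = 0) (x : Fin a → V) : f x * g y = 0 := by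
  classical
  have h := factorial_mul_awedge_apply f g (fun i => Sum.elim x y (finSumFinEquiv.symm i))
  simp only [hfg, AlternatingMap.zero_apply, mul_zero, Equiv.symm_apply_apply] at h
  have hterm : ∀ σ : Perm (Fin a ⊕ Fin b), ((Perm.sign σ : ℤ) : ℝ) *
      (f (fun i => Sum.elim x y (σ (Sum.inl i))) * g (fun i => Sum.elim x y (σ (Sum.inr i)))) =
      if σ ∈ (Perm.sumCongrHom (Fin a) (Fin b)).range then f x * g y else 0 := by
    intro σ
    split_ifs with hσ
    · obtain ⟨⟨τ, ρ⟩, rfl⟩ := hσ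
      have hτ := f.map_perm x τ
      have hρ := g.map_perm y ρ
      simp only [Function.comp_def, Units.smul_def, zsmul_eq_mul] at hτ hρ
      have h₁ : ((Perm.sign τ : ℤ) : ℝ) * ((Perm.sign τ : ℤ) : ℝ) = 1 := by
        rw [← Int.cast_mul, ← Units.val_mul, Int.units_mul_self]; simp
      have h₂ : ((Perm.sign ρ : ℤ) : ℝ) * ((Perm.sign ρ : ℤ) : ℝ) = 1 := by
        rw [← Int.cast_mul, ← Units.val_mul, Int.units_mul_self]; simp
      simp only [Perm.sumCongrHom_apply, Perm.sumCongr_apply, Sum.map_inl, Sum.map_inr,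
        Sum.elim_inl, Sum.elim_inr, Perm.sign_sumCongr, hτ, hρ]
      push_cast
      linear_combination (f x * g y * ((Perm.sign ρ : ℤ) : ℝ) * ((Perm.sign ρ : ℤ) : ℝ)) * h₁ +
        f x * g y * h₂
    · have : ∃ i k, σ (Sum.inl i) = Sum.inr k := by
        by_contra! hne
        refine hσ (Perm.mem_sumCongrHom_range_of_perm_mapsTo_inl ?_)
        rintro _ ⟨i, rfl⟩
        rcases hi : σ (Sum.inl i) with k | k
        · exact ⟨k, rfl⟩
        · exact absurd hi (hne i k)
      obtain ⟨i, k, hik⟩ := this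
      rw [hf k _ i (by simp [hik])]
      simp
  rw [Finset.sum_congr rfl fun σ _ => hterm σ, ← Finset.sum_filter, Finset.sum_const,
    nsmul_eq_mul] at h
  refine (mul_eq_zero.mp h.symm).resolve_left (Nat.cast_ne_zero.mpr ?_)
  exact Finset.card_ne_zero_of_mem (Finset.mem_filter.mpr ⟨Finset.mem_univ 1, one_mem _⟩)

/-- A two-form vanishes as soon as one argument lies in its kernel. -/
theorem apply_eq_zero_of_mem_ker_curryLeft {V : Type*} [AddCommGroup V] [Module ℝ V]
    {f : V [⋀^Fin 2]→ₗ[ℝ] ℝ} {u : V} (hu : u ∈ LinearMap.ker f.curryLeft)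
    (x : Fin 2 → V) (i : Fin 2) (hx : x i = u) : f x = 0 := by
  have h : ∀ w, f ![u, w] = 0 := fun w => DFunLike.congr_fun (LinearMap.mem_ker.mp hu) ![w]
  fin_cases i
  · have hx' : x = ![u, x 1] := by
      ext k; fin_cases k
      · exact hx
      · rfl
    rw [hx', h]
  · have hs := f.map_swap x (i := 0) (j := 1) (by decide)
    have hx' : x ∘ Equiv.swap 0 1 = ![u, x 0] := by
      ext k; fin_cases k
      · simpa using hx
      · simp
    rw [hx', h] at hs
    linarith

/-- If the `T`-valued `2`-form `ω` has uniform rank `N` (every nonzero projection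
`ω_{t*}` satisfies `ω_{t*}^N ≠ 0` and `ω_{t*}^{N+1} = 0`), then for any nonzero
`t₁*, t₂* ∈ T*`, the kernel of `ω_{t₁*}` is isotropic with respect to `ω_{t₂*}`. -/
theorem stmt19 {V T : Type*} [AddCommGroup V] [Module ℝ V] [FiniteDimensional ℝ V]
    [AddCommGroup T] [Module ℝ T] [FiniteDimensional ℝ T] {N : ℕ}
    (ω : V [⋀^Fin 2]→ₗ[ℝ] T)
    (hun : ∀ t : Module.Dual ℝ T, t ≠ 0 →
      wpow (t.compAlternatingMap ω) N ≠ 0 ∧ wpow (t.compAlternatingMap ω) (N + 1) = 0) :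
    ∀ t₁ t₂ : Module.Dual ℝ T, t₁ ≠ 0 → t₂ ≠ 0 →
      ∀ u v : V,
        u ∈ LinearMap.ker (t₁.compAlternatingMap ω).curryLeft →
        v ∈ LinearMap.ker (t₁.compAlternatingMap ω).curryLeft →
        (t₂.compAlternatingMap ω) ![u, v] = 0 := by
  intro t₁ t₂ ht₁ _ u v hu hv
  set f := t₁.compAlternatingMap ω with hf
  set g := t₂.compAlternatingMap ω with hg
  obtain ⟨τ, hτ⟩ : ∃ τ, t₁ τ ≠ 0 := by
    by_contra! h
    exact ht₁ (LinearMap.ext h)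
  have hne : ∀ᶠ s : ℝ in nhds 0, t₁ τ + s * t₂ τ ≠ 0 :=
    ContinuousAt.eventually_ne (by fun_prop) (by simpa using hτ)
  have hw : awedge (wpow f N) g = 0 := by
    ext x
    have hzero : (fun s : ℝ => wpow (f + s • g) (N + 1) x) =ᶠ[nhds 0] fun _ => 0 := by
      filter_upwards [hne] with s hs
      have ht : t₁ + s • t₂ ≠ 0 := fun h => hs (by simpa using DFunLike.congr_fun h τ)
      have hfs : (t₁ + s • t₂).compAlternatingMap ω = f + s • g := by
        ext y
        simp [hf, hg]
      rw [← hfs, (hun _ ht).2, AlternatingMap.zero_apply]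
    have h := (hasDerivAt_wpow_succ f g N x).unique
      ((hasDerivAt_const (0 : ℝ) (0 : ℝ)).congr_of_eventuallyEq hzero)
    rw [AlternatingMap.smul_apply, smul_eq_mul] at h
    exact (mul_eq_zero.mp h).resolve_left (by positivity)
  obtain ⟨x, hx⟩ : ∃ x, wpow f N x ≠ 0 := by
    by_contra! h
    exact (hun t₁ ht₁).1 (AlternatingMap.ext h)
  have hker : ∀ (k : Fin 2) (y : Fin (2 * N) → V) i, y i = ![u, v] k → wpow f N y = 0 := by
    intro k
    fin_cases k
    · exact wpow_apply_eq_zero_of_forall (apply_eq_zero_of_mem_ker_curryLeft hu) N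
    · exact wpow_apply_eq_zero_of_forall (apply_eq_zero_of_mem_ker_curryLeft hv) N
  exact (mul_eq_zero.mp (mul_eq_zero_of_awedge_eq_zero hw hker x)).resolve_left hx
end
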